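/- arXiv:2301.12681 — 2 statements merged into one kernel-verified Lean document; each statement's English description precedes it below -/
import Mathlib

section
/- Let R be an integral domain and A an R-algebra which is an integral domain with tr.deg_R A = d. If A^{[±m]} = A[t₁^{±1}, …, t_m^{±1}] is R-algebra isomorphic to R^{[±(d+m)]} = R[x₁^{±1}, …, x_{d+m}^{±1}] for some m ≥ 1, then A is R-algebra isomorphic to R^{[±d]} = R[y₁^{±1}, …, y_d^{±1}]. (Zariski cancellation for Laurent polynomial rings.) -/
/-- The transcendence degree of an `R`-algebra `A`: the supremum of the cardinalities of
algebraically independent subsets of `A` over `R`.  For an integral domain `A` over an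
integral domain `R` this equals the transcendence degree of `Q(A)` over `Q(R)`. -/
noncomputable def trdeg (R A : Type*) [CommRing R] [CommRing A] [Algebra R A] : Cardinal :=
  ⨆ s : { s : Set A // AlgebraicIndependent R ((↑) : s → A) }, Cardinal.mk s.1

/-- The Laurent polynomial ring `S[t₁^{±1}, …, t_m^{±1}]`, realized as the monoid algebra of
`ℤ^m` over `S`. -/
abbrev LaurentRing (S : Type*) [CommRing S] (m : ℕ) : Type _ :=
  AddMonoidAlgebra S (Fin m → ℤ)

/-- Over a domain, the units of the group algebra of a group with two unique sums are monomials with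
unit coefficient. -/
theorem exists_eq_single_of_isUnit {S G : Type*} [CommRing S] [IsDomain S] [AddCommGroup G]
    [TwoUniqueSums G] {f : AddMonoidAlgebra S G} (hf : IsUnit f) :
    ∃ g r, IsUnit r ∧ f = AddMonoidAlgebra.single g r := by
  classical
  obtain ⟨f', hff'⟩ := hf.exists_right_inv
  have hf0 : f ≠ 0 := fun h => by simp [h] at hff'
  have hf0' : f' ≠ 0 := fun h => by simp [h] at hff'
  have hsum : ∀ p ∈ f.coeff.support ×ˢ f'.coeff.support,
      UniqueAdd f.coeff.support f'.coeff.support p.1 p.2 → p.1 + p.2 = 0 := by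
    intro p hp hu
    rw [Finset.mem_product, Finsupp.mem_support_iff, Finsupp.mem_support_iff] at hp
    have h := AddMonoidAlgebra.coeff_mul_add_of_uniqueAdd hu
    rw [hff', AddMonoidAlgebra.one_def, AddMonoidAlgebra.coeff_single, Finsupp.single_apply] at h
    by_contra hne
    rw [if_neg (Ne.symm hne)] at h
    exact mul_ne_zero hp.1 hp.2 h.symm
  have hle : f.coeff.support.card * f'.coeff.support.card ≤ 1 := by
    by_contra! hlt
    obtain ⟨p, hp, q, hq, hne, hup, huq⟩ := TwoUniqueSums.uniqueAdd_of_one_lt_card hlt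
    have hq' := Finset.mem_product.mp hq
    obtain ⟨h₁, h₂⟩ := hup hq'.1 hq'.2 ((hsum q hq huq).trans (hsum p hp hup).symm)
    exact hne (Prod.ext h₁ h₂).symm
  have hpos : ∀ x : AddMonoidAlgebra S G, x ≠ 0 → 0 < x.coeff.support.card := fun x hx =>
    Finset.card_pos.mpr (Finsupp.support_nonempty_iff.mpr (by simpa using hx))
  have hcard : f.coeff.support.card = 1 := by
    nlinarith [hpos f hf0, hpos f' hf0']
  have hcard' : f'.coeff.support.card = 1 := by
    nlinarith [hpos f hf0, hpos f' hf0']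
  obtain ⟨g, r, -, hg⟩ := Finsupp.card_support_eq_one'.mp hcard
  obtain ⟨g', r', -, hg'⟩ := Finsupp.card_support_eq_one'.mp hcard'
  have hfg : f = AddMonoidAlgebra.single g r := AddMonoidAlgebra.coeff_injective hg
  have hfg' : f' = AddMonoidAlgebra.single g' r' := AddMonoidAlgebra.coeff_injective hg'
  refine ⟨g, r, ?_, hfg⟩
  have h := congrArg (fun x => x.coeff 0) hff'
  rw [hfg, hfg', AddMonoidAlgebra.single_mul_single] at h
  simp only [AddMonoidAlgebra.one_def, AddMonoidAlgebra.coeff_single, Finsupp.single_apply,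
    if_true] at h
  split_ifs at h with h0
  · exact IsUnit.of_mul_eq_one _ h
  · exact absurd h zero_ne_one

/-- The kernel of a surjection `ℤ^(d + m) → ℤ^m` is free of rank `d`. -/
theorem nonempty_ker_linearEquiv_of_surjective {d m : ℕ}
    (p : (Fin (d + m) → ℤ) →ₗ[ℤ] (Fin m → ℤ)) (hp : Function.Surjective p) :
    Nonempty (LinearMap.ker p ≃ₗ[ℤ] (Fin d → ℤ)) := by
  have h := (LinearMap.ker p).finrank_quotient_add_finrank
  rw [(p.quotKerEquivOfSurjective hp).finrank_eq, Module.finrank_fin_fun,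
    Module.finrank_fin_fun] at h
  exact ⟨(Module.finBasisOfFinrankEq ℤ (LinearMap.ker p) (by omega)).equivFun⟩

/-- The exponents in `A[H]` of the images of the monomials under an isomorphism
`R[E] ≃ₐ[R] A[H]`. -/
theorem exists_exponent_hom {R A E H : Type*} [CommRing R] [CommRing A] [IsDomain A]
    [Algebra R A] [AddCommGroup E] [AddCommGroup H] [TwoUniqueSums H]
    (ψ : AddMonoidAlgebra R E →ₐ[R] AddMonoidAlgebra A H) :
    ∃ p : E →+ H, ∀ e, ∃ a : A, IsUnit a ∧
      ψ (AddMonoidAlgebra.single e 1) = AddMonoidAlgebra.single (p e) a := by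
  have hunit : ∀ e : E, IsUnit (AddMonoidAlgebra.single e (1 : R)) := fun e =>
    IsUnit.of_mul_eq_one (AddMonoidAlgebra.single (-e) 1) (by
      rw [AddMonoidAlgebra.single_mul_single, add_neg_cancel, one_mul,
        AddMonoidAlgebra.one_def])
  choose p a ha hpa using fun e => exists_eq_single_of_isUnit ((hunit e).map ψ)
  refine ⟨AddMonoidHom.mk' p fun e e' => ?_, fun e => ⟨a e, ha e, hpa e⟩⟩
  have h : AddMonoidAlgebra.single (p (e + e')) (a (e + e')) =
      AddMonoidAlgebra.single (p e + p e') (a e * a e') := by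
    rw [← hpa, ← AddMonoidAlgebra.single_mul_single, ← hpa, ← hpa, ← map_mul,
      AddMonoidAlgebra.single_mul_single, one_mul]
  have h' := congrArg AddMonoidAlgebra.coeff h
  rw [AddMonoidAlgebra.coeff_single, AddMonoidAlgebra.coeff_single,
    Finsupp.single_eq_single_iff] at h'
  rcases h' with h' | h'
  · exact h'.1
  · exact absurd h'.1 (ha _).ne_zero

/-- If `R[E] ≃ₐ[R] A[H]`, then the kernel `K` of a suitable surjection `E → H` satisfies
`R[K] ≃ₐ[R] A`. -/
theorem exists_surjective_algEquiv_ker {R A E H : Type*} [CommRing R] [IsDomain R] [CommRing A]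
    [IsDomain A] [Algebra R A] [AddCommGroup E] [AddCommGroup H] [TwoUniqueSums E]
    [TwoUniqueSums H] (ψ : AddMonoidAlgebra R E ≃ₐ[R] AddMonoidAlgebra A H) :
    ∃ p : E →+ H, Function.Surjective p ∧
      Nonempty (AddMonoidAlgebra R p.ker ≃ₐ[R] A) := by
  obtain ⟨p, hp⟩ := exists_exponent_hom (ψ : AddMonoidAlgebra R E →ₐ[R] AddMonoidAlgebra A H)
  simp only [AlgEquiv.coe_toAlgHom] at hp
  let ε : AddMonoidAlgebra A H →ₐ[R] A := (AddMonoidAlgebra.lift A A H 1).restrictScalars R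
  have hε : ∀ h a, ε (AddMonoidAlgebra.single h a) = a := fun h a => by
    simp [ε, AddMonoidAlgebra.lift_single]
  let ι : AddMonoidAlgebra R p.ker →ₐ[R] AddMonoidAlgebra R E :=
    AddMonoidAlgebra.mapDomainAlgHom R R p.ker.subtype
  have hι : ∀ k r, ι (AddMonoidAlgebra.single k r) = AddMonoidAlgebra.single (k : E) r :=
    fun k r => by simp [ι]
  have hιinj : Function.Injective ι :=
    AddMonoidAlgebra.mapDomain_injective Subtype.val_injective
  -- The monomials of `A[H]` come from monomials of `R[E]`, up to units of `R`.
  have hmono : ∀ h : H, ∃ (e : E) (r : R), p e = h ∧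
      ε (ψ (AddMonoidAlgebra.single e 1)) = algebraMap R A r := by
    intro h
    have hu : IsUnit (AddMonoidAlgebra.single h (1 : A)) :=
      IsUnit.of_mul_eq_one (AddMonoidAlgebra.single (-h) 1) (by
        rw [AddMonoidAlgebra.single_mul_single, add_neg_cancel, one_mul,
          AddMonoidAlgebra.one_def])
    obtain ⟨e, r, hr, her⟩ := exists_eq_single_of_isUnit (hu.map ψ.symm)
    obtain ⟨a, -, hea⟩ := hp e
    have h1 : AddMonoidAlgebra.single h (1 : A) =
        AddMonoidAlgebra.single (p e) (algebraMap R A r * a) := by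
      rw [← Algebra.smul_def, ← AddMonoidAlgebra.smul_single, ← hea, ← map_smul,
        AddMonoidAlgebra.smul_single, smul_eq_mul, mul_one, ← her, AlgEquiv.apply_symm_apply]
    have h2 := congrArg AddMonoidAlgebra.coeff h1
    rw [AddMonoidAlgebra.coeff_single, AddMonoidAlgebra.coeff_single,
      Finsupp.single_eq_single_iff] at h2
    rcases h2 with h2 | h2
    · obtain ⟨s, hs⟩ := hr.exists_right_inv
      refine ⟨e, s, h2.1.symm, ?_⟩
      rw [hea, hε]
      calc a = algebraMap R A (r * s) * a := by rw [hs, map_one, one_mul]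
        _ = algebraMap R A s * (algebraMap R A r * a) := by rw [map_mul]; ring
        _ = algebraMap R A s := by rw [← h2.2, mul_one]
    · exact absurd h2.1 one_ne_zero
  refine ⟨p, fun h => ?_, ⟨AlgEquiv.ofBijective (ε.comp ((ψ : _ →ₐ[R] _).comp ι)) ⟨?_, ?_⟩⟩⟩
  · obtain ⟨e, -, he, -⟩ := hmono h
    exact ⟨e, he⟩
  · have hcomp : ∀ x, ψ (ι x) = AddMonoidAlgebra.single 0 (ε (ψ (ι x))) := by
      intro x
      refine AlgHom.congr_fun (φ₁ := (ψ : _ →ₐ[R] _).comp ι)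
        (φ₂ := (Algebra.ofId A (AddMonoidAlgebra A H)).restrictScalars R |>.comp
          (ε.comp ((ψ : _ →ₐ[R] _).comp ι))) (AddMonoidAlgebra.algHom_ext (fun k => ?_) ?_) x
      · obtain ⟨a, -, hka⟩ := hp k
        rw [(AddMonoidHom.mem_ker).mp k.2] at hka
        simp [hι, hka, hε, Algebra.ofId_apply]
      · ext
    intro x y hxy
    refine hιinj (ψ.injective ?_)
    rw [hcomp x, hcomp y]
    exact congrArg _ hxy
  · have hrange : ∀ f, ε (ψ f) ∈ (ε.comp ((ψ : _ →ₐ[R] _).comp ι)).range := by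
      intro f
      induction f using AddMonoidAlgebra.induction_linear with
      | zero => simp
      | add f g hf hg => simpa only [map_add] using add_mem hf hg
      | single e r =>
        obtain ⟨e', s, hpe, hs⟩ := hmono (p e)
        have hk : e - e' ∈ p.ker := by
          rw [AddMonoidHom.mem_ker, map_sub, hpe, sub_self]
        refine ⟨s • AddMonoidAlgebra.single ⟨e - e', hk⟩ r, ?_⟩
        have hprod : AddMonoidAlgebra.single e r =
            AddMonoidAlgebra.single e' (1 : R) * AddMonoidAlgebra.single (e - e') r := by
          rw [AddMonoidAlgebra.single_mul_single, add_sub_cancel, one_mul]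
        rw [hprod, map_mul, map_mul, hs, ← Algebra.smul_def]
        simp only [AlgHom.toRingHom_eq_coe, RingHom.coe_coe, map_smul, AlgHom.comp_apply, hι,
          AlgEquiv.coe_toAlgHom]
    intro a
    obtain ⟨x, hx⟩ := hrange (ψ.symm (AddMonoidAlgebra.single 0 a))
    exact ⟨x, by rw [← hε 0 a, ← ψ.apply_symm_apply (AddMonoidAlgebra.single 0 a)]; exact hx⟩

/-- **Zariski cancellation for Laurent polynomial rings.**  Let `R` be an integral domain
and `A` an `R`-algebra integral domain with `tr.deg_R A = d`.  If
`A^{[±m]} ≅ R^{[±(d+m)]}` as `R`-algebras for some `m ≥ 1`, then `A ≅ R^{[±d]}` as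
`R`-algebras. -/
theorem laurent_cancellation (R A : Type*) [CommRing R] [IsDomain R] [CommRing A] [IsDomain A]
    [Algebra R A] (d m : ℕ) (hm : 1 ≤ m) (htr : trdeg R A = (d : Cardinal))
    (h : Nonempty (LaurentRing A m ≃ₐ[R] LaurentRing R (d + m))) :
    Nonempty (A ≃ₐ[R] LaurentRing R d) := by
  obtain ⟨φ⟩ := h
  obtain ⟨p, hp, ⟨e⟩⟩ := exists_surjective_algEquiv_ker φ.symm
  obtain ⟨q⟩ := nonempty_ker_linearEquiv_of_surjective p.toIntLinearMap hp
  exact ⟨e.symm.trans (AddMonoidAlgebra.domCongr R R q.toAddEquiv)⟩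
end

section
/- Let R be a unique factorization domain, 1 ≤ d ≤ n = 3, B = R[x₁^{±1}, …, x_d^{±1}, x_{d+1}, …, x₃], φ : B → B an R-algebra homomorphism with φ ∘ φ = φ, A = φ(B), and r the rank of U_R(A) = A^*/R^*. Then A is R-algebra isomorphic to R^{[±r]} ⊗_R R^{[s]} = R[y₁^{±1}, …, y_r^{±1}, z₁, …, z_s] for some s ∈ {0, 1, 2}. -/
/-- The (torsion-free) rank of an abelian group, written multiplicatively. -/
noncomputable def groupRank (G : Type*) [CommGroup G] : Cardinal :=
  @Module.rank ℤ (Additive G) _ _ (AddCommGroup.toIntModule _)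

/-- The mixed Laurent/polynomial ring `R[x₁^{±1}, …, x_d^{±1}, x_{d+1}, …, x_{d+m}]`,
realized as the monoid algebra of `ℤ^d × ℕ^m` over `R`. -/
abbrev MixedLaurent (R : Type*) [CommRing R] (d m : ℕ) : Type _ :=
  AddMonoidAlgebra R ((Fin d → ℤ) × (Fin m → ℕ))

/-- `U_R(A) = A^*/R^*`, the quotient of the unit group of `A` by the image of `R^*`. -/
abbrev URGroup (R A : Type*) [CommRing R] [CommRing A] [Algebra R A] : Type _ :=
  Aˣ ⧸ (Units.map (algebraMap R A : R →* A)).range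

universe u v

section

open Polynomial

theorem UniqueFactorizationMonoid.of_retract {A B : Type*} [CommRing A] [CommRing B] [IsDomain B]
    [UniqueFactorizationMonoid B] (i : A →+* B) (π : B →+* A) (hπ : ∀ a, π (i a) = a) :
    UniqueFactorizationMonoid A := by
  have hi : Function.Injective i := Function.LeftInverse.injective hπ
  have : IsDomain A := hi.isDomain i
  have : WfDvdMonoid A := by
    refine ⟨Subrelation.wf (r := InvImage DvdNotUnit i) ?_ (InvImage.wf i wellFounded_dvdNotUnit)⟩
    rintro a b ⟨ha, x, hx, rfl⟩
    refine ⟨(map_ne_zero_iff i hi).2 ha, i x, fun h => hx ?_, map_mul i a x⟩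
    simpa [hπ] using h.map π
  have : DecompositionMonoid A := by
    refine ⟨fun a b c h => ?_⟩
    obtain ⟨a₁, a₂, h₁, h₂, h₃⟩ := exists_dvd_and_dvd_of_dvd_mul (map_mul i b c ▸ map_dvd i h)
    exact ⟨π a₁, π a₂, by simpa [hπ] using map_dvd π h₁, by simpa [hπ] using map_dvd π h₂,
      by rw [← map_mul, ← h₃, hπ]⟩
  infer_instance

theorem Polynomial.exists_eq_X_pow_mul_coeff_zero_ne_zero {S : Type*} [CommRing S] [IsDomain S]
    {p : S[X]} (hp : p ≠ 0) : ∃ (k : ℕ) (q : S[X]), p = X ^ k * q ∧ q.coeff 0 ≠ 0 := by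
  obtain ⟨q, hq, h⟩ := exists_eq_pow_rootMultiplicity_mul_and_not_dvd p hp 0
  exact ⟨_, q, by simpa using hq, by simpa [X_dvd_iff] using h⟩

section Retract

variable {S A : Type*} [CommRing S] [IsDomain S] [CommRing A] [IsDomain A] [Algebra S A]

theorem transcendental_of_map_eq_zero (α : A →ₐ[S] S) {h : A} (h0 : h ≠ 0) (hα : α h = 0) :
    Transcendental S h := by
  rintro ⟨p, hp, hph⟩
  obtain ⟨k, q, rfl, hq⟩ := exists_eq_X_pow_mul_coeff_zero_ne_zero hp
  have hqh : aeval h q = 0 := by simpa [h0] using hph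
  apply hq
  rw [← map_zero α, ← hqh, ← aeval_algHom_apply, hα, ← coeff_zero_eq_aeval_zero]

theorem dvd_of_map_eq_zero [UniqueFactorizationMonoid S] (htr : Algebra.trdeg S A ≤ 1)
    (α : A →ₐ[S] S) {h a : A} (hp : Prime h) (hα : α h = 0) (ha : α a = 0) : h ∣ a := by
  have hh := transcendental_of_map_eq_zero α hp.ne_zero hα
  have hinj : Function.Injective (algebraMap S A) := fun x y hxy => by
    simpa using congrArg α hxy
  have := (faithfulSMul_iff_algebraMap_injective S A).mpr hinj
  have hb : IsTranscendenceBasis S (fun _ : Unit => h) := by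
    refine AlgebraicIndependent.isTranscendenceBasis_of_lift_trdeg_le_of_finite
      (algebraicIndependent_unique_type_iff.2 hh) ?_
    simpa using htr
  have halg := hb.isAlgebraic
  obtain ⟨q, hq0, hqa⟩ := halg.isAlgebraic a
  let f : S[X] →+* A := (aeval h : S[X] →ₐ[S] A)
  obtain ⟨Q, hQ0, hQ⟩ : ∃ Q : S[X][X], Q ≠ 0 ∧ Q.eval₂ f a = 0 := by
    have hmem : ∀ x : Algebra.adjoin S (Set.range fun _ : Unit => h), (x : A) ∈ f.range := by
      rintro ⟨x, hx⟩
      rw [Set.range_const, Algebra.adjoin_singleton_eq_range_aeval] at hx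
      exact hx
    have hmem' : q.map (algebraMap _ A) ∈ Polynomial.lifts f := by
      rw [Polynomial.lifts_iff_coeff_lifts]
      intro n
      rw [coeff_map]
      exact hmem _
    obtain ⟨Q, hQ⟩ := hmem'
    rw [coe_mapRingHom] at hQ
    refine ⟨Q, ?_, ?_⟩
    · rintro rfl
      apply hq0
      apply Polynomial.map_injective (algebraMap _ A) Subtype.val_injective
      rw [← hQ]; simp
    · rw [← eval_map, hQ, eval_map]
      exact hqa
  have hCX : Prime (C X : S[X][X]) := prime_C_iff.2 prime_X
  obtain ⟨n, Q', hdvd, rfl⟩ := WfDvdMonoid.max_power_factor hQ0 hCX.irreducible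
  have hQ' : Q'.eval₂ f a = 0 := by
    have : f X = h := by simp [f]
    simpa [eval₂_mul, eval₂_pow, this, hp.ne_zero] using hQ
  have hq : Q'.map (evalRingHom 0) ≠ 0 := by
    contrapose! hdvd
    rw [C_dvd_iff_dvd_coeff]
    intro i
    rw [X_dvd_iff, coeff_zero_eq_eval_zero, ← coe_evalRingHom, ← coeff_map, hdvd, coeff_zero]
  have key : h ∣ aeval a (Q'.map (evalRingHom 0)) := by
    rw [← Ideal.mem_span_singleton, ← Ideal.Quotient.eq_zero_iff_mem, aeval_def, hom_eval₂,
      eval₂_map]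
    have hcomp : ((Ideal.Quotient.mk (Ideal.span {h})).comp (algebraMap S A)).comp (evalRingHom 0) =
        (Ideal.Quotient.mk (Ideal.span {h})).comp f := by
      ext
      · simp [f]
      · simp [f]
    rw [hcomp, ← hom_eval₂, hQ', map_zero]
  obtain ⟨k, q₁, hq₁, hc⟩ := exists_eq_X_pow_mul_coeff_zero_ne_zero hq
  rw [hq₁, map_mul, map_pow, aeval_X] at key
  rcases hp.dvd_or_dvd key with h1 | h1
  · exact hp.dvd_of_dvd_pow h1
  · obtain ⟨b, hb⟩ := h1
    exfalso
    apply hc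
    have := congrArg α hb
    rw [map_mul, hα, zero_mul, ← aeval_algHom_apply, ha, ← coeff_zero_eq_aeval_zero] at this
    exact this

end Retract

theorem trdeg_lt_of_surjective_of_not_injective {S A : Type*} [CommRing S] [CommRing A]
    [IsDomain A] [Algebra S A] [FaithfulSMul S A] {m : ℕ}
    {π : MvPolynomial (Fin m) S →ₐ[S] A} (hs : Function.Surjective π)
    (hn : ¬ Function.Injective π) : Algebra.trdeg S A < m := by
  have hπ : π = MvPolynomial.aeval (fun k => π (MvPolynomial.X k)) := MvPolynomial.aeval_unique π
  by_contra! hle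
  apply hn
  have htop : Algebra.adjoin S (Set.range fun k => π (MvPolynomial.X k)) = ⊤ := by
    rw [← MvPolynomial.aeval_range, ← hπ, AlgHom.range_eq_top]
    exact hs
  have : Algebra.IsAlgebraic (Algebra.adjoin S (Set.range fun k => π (MvPolynomial.X k))) A := by
    rw [htop]
    exact ⟨fun a => isAlgebraic_algebraMap (⟨a, trivial⟩ : (⊤ : Subalgebra S A))⟩
  have hb := Algebra.IsAlgebraic.isTranscendenceBasis_of_lift_le_trdeg_of_finite S
    (fun k => π (MvPolynomial.X k)) (by simpa using hle)
  rw [hπ]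
  exact hb.1

theorem MvPolynomial.nonempty_algEquiv_of_retract {S A : Type*} [CommRing S] [IsDomain S]
    [UniqueFactorizationMonoid S] [CommRing A] [Algebra S A] {m : ℕ} (hm : m ≤ 2)
    (i : A →ₐ[S] MvPolynomial (Fin m) S) (π : MvPolynomial (Fin m) S →ₐ[S] A)
    (hπ : ∀ a, π (i a) = a) : ∃ s ≤ 2, Nonempty (A ≃ₐ[S] MvPolynomial (Fin s) S) := by
  have hi : Function.Injective i := Function.LeftInverse.injective hπ
  have hs : Function.Surjective π := Function.RightInverse.surjective hπ
  have : IsDomain A := hi.isDomain i.toRingHom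
  have : UniqueFactorizationMonoid A := .of_retract i.toRingHom π.toRingHom hπ
  by_cases hinj : Function.Injective π
  · exact ⟨m, hm, ⟨(AlgEquiv.ofBijective π ⟨hinj, hs⟩).symm⟩⟩
  let α : A →ₐ[S] S := (MvPolynomial.aeval 0).comp i
  have hα : ∀ x, α (algebraMap S A x) = x := fun x => by simp
  have := (faithfulSMul_iff_algebraMap_injective S A).mpr (Function.LeftInverse.injective hα)
  have htr : Algebra.trdeg S A ≤ 1 := by
    have h1 : Algebra.trdeg S A < (2 : ℕ) :=
      (trdeg_lt_of_surjective_of_not_injective hs hinj).trans_le (by exact_mod_cast hm)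
    rw [show ((2 : ℕ) : Cardinal) = Order.succ ((1 : ℕ) : Cardinal) by
      rw [Cardinal.succ_natCast]; norm_num] at h1
    simpa using Order.lt_succ_iff.1 h1
  by_cases hbot : RingHom.ker α.toRingHom = ⊥
  · refine ⟨0, by norm_num, ⟨(AlgEquiv.ofBijective α ⟨?_, fun x => ⟨_, hα x⟩⟩).trans
      (MvPolynomial.isEmptyAlgEquiv S (Fin 0)).symm⟩⟩
    exact (RingHom.injective_iff_ker_eq_bot α.toRingHom).2 hbot
  obtain ⟨h, hmem, hp⟩ :=
    (RingHom.ker_isPrime α.toRingHom).exists_mem_prime_of_ne_bot hbot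
  replace hmem : α h = 0 := hmem
  have hdeg : 0 < (i h).totalDegree := by
    rw [Nat.pos_iff_ne_zero]
    intro h0
    rw [MvPolynomial.totalDegree_eq_zero_iff_eq_C] at h0
    apply hp.ne_zero
    have h1 := hπ h
    rw [h0] at h1
    have h2 : α h = _ := congrArg α h1.symm
    rw [← MvPolynomial.algebraMap_eq, AlgHom.commutes, hα, hmem] at h2
    rw [← h1, ← h2, MvPolynomial.C_0, map_zero]
  have hsurj : ∀ (n : ℕ) (a : A), (i a).totalDegree < n →
      a ∈ (Polynomial.aeval h : S[X] →ₐ[S] A).range := by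
    intro n
    induction n with
    | zero => intro a ha; omega
    | succ n ih =>
      intro a ha
      obtain ⟨b, hb⟩ := dvd_of_map_eq_zero htr α (a := a - algebraMap S A (α a)) hp hmem
        (by simp [hα])
      have hab : a = algebraMap S A (α a) + h * b := by rw [← hb]; ring
      rw [hab]
      refine add_mem (Subalgebra.algebraMap_mem _ _) (mul_mem ⟨Polynomial.X, by simp⟩ ?_)
      by_cases hb0 : b = 0
      · rw [hb0]; exact zero_mem _
      apply ih
      have h1 : (i h * i b).totalDegree ≤ (i a).totalDegree := by
        rw [← map_mul, ← hb, map_sub, AlgHom.commutes, MvPolynomial.algebraMap_eq]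
        exact (MvPolynomial.totalDegree_sub _ _).trans (by simp)
      rw [MvPolynomial.totalDegree_mul_of_isDomain ((map_ne_zero_iff i hi).2 hp.ne_zero)
        ((map_ne_zero_iff i hi).2 hb0)] at h1
      omega
  refine ⟨1, by norm_num, ⟨((AlgEquiv.ofBijective (Polynomial.aeval h : S[X] →ₐ[S] A)
    ⟨?_, fun a => hsurj _ a (Nat.lt_succ_self _)⟩).symm.trans
      (MvPolynomial.uniqueAlgEquiv S (Fin 1)).symm)⟩⟩
  exact transcendental_iff_injective.1 (transcendental_of_map_eq_zero α hp.ne_zero hmem)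

end

section

open AddMonoidAlgebra

theorem AddMonoidAlgebra.exists_eq_single_of_mul_eq_one {R M : Type*} [CommRing R] [IsDomain R]
    [AddCommMonoid M] [TwoUniqueSums M] {u v : AddMonoidAlgebra R M} (huv : u * v = 1) :
    ∃ (a b : M) (c : Rˣ), a + b = 0 ∧ u = single a (c : R) := by
  classical
  have hu : u ≠ 0 := left_ne_zero_of_mul_eq_one huv
  have hv : v ≠ 0 := right_ne_zero_of_mul_eq_one huv
  have hu' : u.coeff.support.Nonempty := by
    rwa [Finsupp.support_nonempty_iff, ne_eq, coeff_eq_zero]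
  have hv' : v.coeff.support.Nonempty := by
    rwa [Finsupp.support_nonempty_iff, ne_eq, coeff_eq_zero]
  have hzero : ∀ a ∈ u.coeff.support, ∀ b ∈ v.coeff.support,
      UniqueAdd u.coeff.support v.coeff.support a b → a + b = 0 := by
    intro a ha b hb h
    by_contra hne
    have h1 := coeff_mul_add_of_uniqueAdd h
    rw [huv, one_def, coeff_single, Finsupp.single_eq_of_ne hne] at h1
    exact mul_ne_zero (Finsupp.mem_support_iff.1 ha) (Finsupp.mem_support_iff.1 hb) h1.symm
  have hcard : ¬ 1 < u.coeff.support.card * v.coeff.support.card := by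
    intro hc
    obtain ⟨p, hp, q, hq, hpq, h1, h2⟩ := TwoUniqueSums.uniqueAdd_of_one_lt_card hc
    rw [Finset.mem_product] at hp hq
    have e1 := hzero _ hp.1 _ hp.2 h1
    have e2 := hzero _ hq.1 _ hq.2 h2
    obtain ⟨h3, h4⟩ := h1 hq.1 hq.2 (e2.trans e1.symm)
    exact hpq (Prod.ext h3.symm h4.symm)
  have hu1 := hu'.card_pos
  have hv1 := hv'.card_pos
  have hcu : u.coeff.support.card = 1 := by nlinarith
  have hcv : v.coeff.support.card = 1 := by nlinarith
  obtain ⟨a, ha, hua⟩ := Finsupp.card_support_eq_one.1 hcu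
  obtain ⟨b, hb, hvb⟩ := Finsupp.card_support_eq_one.1 hcv
  have hua' : u = single a (u.coeff a) := coeff_injective (by rw [coeff_single]; exact hua)
  have hvb' : v = single b (v.coeff b) := coeff_injective (by rw [coeff_single]; exact hvb)
  have hprod := huv
  rw [hua', hvb', single_mul_single, one_def] at hprod
  rcases single_inj.1 hprod with ⟨h0, h1⟩ | ⟨-, h1⟩
  · exact ⟨a, b, Units.mkOfMulEqOne _ _ h1, h0, hua'⟩
  · exact absurd h1 one_ne_zero

end

theorem MixedLaurent.exists_eq_single_of_isUnit {R : Type*} [CommRing R] [IsDomain R] {d m : ℕ}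
    {u : MixedLaurent R d m} (hu : IsUnit u) :
    ∃ (a : Fin d → ℤ) (c : Rˣ), u = AddMonoidAlgebra.single (a, 0) (c : R) := by
  obtain ⟨v, hv⟩ := hu.exists_right_inv
  obtain ⟨a, b, c, hab, rfl⟩ := AddMonoidAlgebra.exists_eq_single_of_mul_eq_one hv
  refine ⟨a.1, c, ?_⟩
  have h2 : a.2 = 0 := by
    funext k
    exact (Nat.add_eq_zero_iff.1 (congrFun (congrArg Prod.snd hab) k)).1
  rw [← h2]

theorem groupRank_congr {G : Type u} {H : Type v} [CommGroup G] [CommGroup H] (e : G ≃* H) :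
    Cardinal.lift.{v} (groupRank.{u} G) = Cardinal.lift.{u} (groupRank.{v} H) :=
  (MulEquiv.toAdditive e).toIntLinearEquiv.lift_rank_eq

theorem groupRank_quotient_congr {G : Type u} {H : Type v} [CommGroup G] [CommGroup H]
    (N : Subgroup G) (K : Subgroup H) (e : G ≃* H) (h : N.map e.toMonoidHom = K) :
    Cardinal.lift.{v} (groupRank (G ⧸ N)) = Cardinal.lift.{u} (groupRank (H ⧸ K)) :=
  groupRank_congr (QuotientGroup.congr N K e h)

theorem groupRank_quotient_of_hom {F : Type u} {G : Type v} [CommGroup F] [CommGroup G]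
    (H : Subgroup G) (f : F →* G) (hinj : ∀ a, f a ∈ H → a = 1)
    (hsurj : ∀ g, ∃ a, (f a)⁻¹ * g ∈ H) :
    Cardinal.lift.{v} (groupRank.{u} F) = Cardinal.lift.{u} (groupRank.{v} (G ⧸ H)) := by
  refine groupRank_congr (MulEquiv.ofBijective ((QuotientGroup.mk' H).comp f) ⟨?_, fun x => ?_⟩)
  · rw [injective_iff_map_eq_one]
    exact fun a ha => hinj a ((QuotientGroup.eq_one_iff _).1 ha)
  · obtain ⟨g, rfl⟩ := QuotientGroup.mk_surjective x
    obtain ⟨a, ha⟩ := hsurj g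
    exact ⟨a, QuotientGroup.eq.2 ha⟩

theorem groupRank_multiplicative_pi_int (r : ℕ) :
    groupRank (Multiplicative (Fin r → ℤ)) = r := by
  have e : Additive (Multiplicative (Fin r → ℤ)) ≃+ (Fin r → ℤ) := AddEquiv.refl _
  exact e.toIntLinearEquiv.rank_eq.trans (rank_fin_fun r)

/-- The Laurent monomials, as units of the mixed Laurent ring. -/
noncomputable def MixedLaurent.monomialUnit (R : Type*) [CommRing R] (r s : ℕ) :
    Multiplicative (Fin r → ℤ) →* (MixedLaurent R r s)ˣ :=
  MonoidHom.toHomUnits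
    ((AddMonoidAlgebra.of R _).comp (AddMonoidHom.toMultiplicative (AddMonoidHom.inl _ _)))

theorem MixedLaurent.coe_monomialUnit (R : Type*) [CommRing R] (r s : ℕ)
    (a : Multiplicative (Fin r → ℤ)) :
    (monomialUnit R r s a : MixedLaurent R r s) = AddMonoidAlgebra.single (a.toAdd, 0) 1 := rfl

theorem MixedLaurent.groupRank_URGroup (R : Type*) [CommRing R] [IsDomain R] (r s : ℕ) :
    groupRank (URGroup R (MixedLaurent R r s)) = r := by
  have h := groupRank_quotient_of_hom
    (Units.map (algebraMap R (MixedLaurent R r s) : R →* MixedLaurent R r s)).range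
    (monomialUnit R r s) ?_ ?_
  · rw [groupRank_multiplicative_pi_int] at h
    simpa using h.symm
  · rintro a ⟨c, hc⟩
    have h1 := congrArg (Units.val) hc
    rw [coe_monomialUnit] at h1
    rcases AddMonoidAlgebra.single_inj.1 h1 with ⟨h2, -⟩ | ⟨-, h2⟩
    · exact (congrArg Prod.fst h2).symm
    · exact absurd h2 one_ne_zero
  · intro u
    obtain ⟨a, c, h⟩ := exists_eq_single_of_isUnit u.isUnit
    refine ⟨Multiplicative.ofAdd a, c, ?_⟩
    rw [eq_inv_mul_iff_mul_eq]
    ext1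
    rw [Units.val_mul, coe_monomialUnit, h]
    simp [AddMonoidAlgebra.single_mul_single]

theorem groupRank_URGroup_congr {R : Type*} {A : Type u} {B : Type v} [CommRing R] [CommRing A]
    [CommRing B] [Algebra R A] [Algebra R B] (e : A ≃ₐ[R] B) :
    Cardinal.lift.{v} (groupRank (URGroup R A)) = Cardinal.lift.{u} (groupRank (URGroup R B)) :=
  groupRank_quotient_congr _ _ (Units.mapEquiv e.toMulEquiv) <| by
    rw [MonoidHom.map_range]
    congr 1
    ext c
    simp

theorem LaurentPolynomial.uniqueFactorizationMonoid (R : Type*) [CommRing R] [IsDomain R]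
    [UniqueFactorizationMonoid R] : UniqueFactorizationMonoid (LaurentPolynomial R) :=
  .of_isLocalization (Submonoid.powers (Polynomial.X : Polynomial R)) _

theorem AddMonoidAlgebra.uniqueFactorizationMonoid_pi_int (R : Type*) [CommRing R] [IsDomain R]
    [UniqueFactorizationMonoid R] (r : ℕ) :
    UniqueFactorizationMonoid (AddMonoidAlgebra R (Fin r → ℤ)) := by
  induction r with
  | zero =>
    exact (AddMonoidAlgebra.uniqueRingEquiv (R := R) (Fin 0 → ℤ)).symm.toMulEquiv
      |>.uniqueFactorizationMonoid ‹_›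
  | succ r ih =>
    let e : ℤ × (Fin r → ℤ) ≃+ (Fin (r + 1) → ℤ) :=
      (Fin.consLinearEquiv ℤ (fun _ : Fin (r + 1) => ℤ)).toAddEquiv
    have := LaurentPolynomial.uniqueFactorizationMonoid (AddMonoidAlgebra R (Fin r → ℤ))
    exact ((AddMonoidAlgebra.curryRingEquiv (R := R) (M := ℤ) (N := Fin r → ℤ)).symm.trans
      (AddMonoidAlgebra.domCongr R R e).toRingEquiv).toMulEquiv.uniqueFactorizationMonoid this

/-- The mixed Laurent ring as a polynomial ring over the ring of Laurent polynomials. -/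
noncomputable def MixedLaurent.mvPolynomialEquiv (R : Type*) [CommRing R] (r s : ℕ) :
    MvPolynomial (Fin s) (AddMonoidAlgebra R (Fin r → ℤ)) ≃ₐ[R] MixedLaurent R r s :=
  ((AddMonoidAlgebra.curryAlgEquiv R (A := R) (M := Fin s →₀ ℕ) (N := Fin r → ℤ)).symm.trans
    (AddMonoidAlgebra.domCongr R R
      ((AddEquiv.prodComm).trans
        ((AddEquiv.refl (Fin r → ℤ)).prodCongr
          (Finsupp.linearEquivFunOnFinite ℕ ℕ (Fin s)).toAddEquiv))))

theorem MixedLaurent.exists_map_single (R : Type*) [CommRing R] [IsDomain R] {d m : ℕ}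
    (φ : MixedLaurent R d m →ₐ[R] MixedLaurent R d m) :
    ∃ (e : (Fin d → ℤ) →+ (Fin d → ℤ)) (c : Multiplicative (Fin d → ℤ) →* Rˣ), ∀ v,
      φ (AddMonoidAlgebra.single (v, 0) 1) =
        AddMonoidAlgebra.single (e v, 0) (c (Multiplicative.ofAdd v) : R) := by
  have h : ∀ v : Fin d → ℤ, ∃ (a : Fin d → ℤ) (c : Rˣ),
      φ (AddMonoidAlgebra.single (v, 0) 1) = AddMonoidAlgebra.single (a, 0) (c : R) := fun v =>
    exists_eq_single_of_isUnit
      ((monomialUnit R d m (Multiplicative.ofAdd v)).isUnit.map φ)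
  choose e c h using h
  have hadd : ∀ v w, e (v + w) = e v + e w ∧ c (v + w) = c v * c w := by
    intro v w
    have h1 : φ (AddMonoidAlgebra.single (v, 0) 1 * AddMonoidAlgebra.single (w, 0) 1) = _ :=
      map_mul φ _ _
    rw [AddMonoidAlgebra.single_mul_single, h v, h w, AddMonoidAlgebra.single_mul_single,
      Prod.mk_add_mk, Prod.mk_add_mk, add_zero, mul_one, h, ← Units.val_mul] at h1
    rcases AddMonoidAlgebra.single_inj.1 h1 with ⟨h2, h3⟩ | ⟨h2, -⟩
    · exact ⟨congrArg Prod.fst h2, Units.ext h3⟩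
    · exact absurd h2 (Units.ne_zero _)
  exact ⟨AddMonoidHom.mk' e fun v w => (hadd v w).1,
    MonoidHom.mk' (fun v => c v.toAdd) fun v w => (hadd v.toAdd w.toAdd).2, h⟩

theorem AddMonoidHom.exists_factor_of_idempotent {d : ℕ} (e : (Fin d → ℤ) →+ (Fin d → ℤ))
    (he : ∀ v, e (e v) = e v) :
    ∃ (r : ℕ) (ι : (Fin r → ℤ) →+ (Fin d → ℤ)) (κ : (Fin d → ℤ) →+ (Fin r → ℤ)),
      (∀ w, κ (ι w) = w) ∧ ∀ v, ι (κ v) = e v := by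
  let f : (Fin d → ℤ) →ₗ[ℤ] (Fin d → ℤ) := e.toIntLinearMap
  let b := (Module.finBasis ℤ (LinearMap.range f)).equivFun
  refine ⟨_, ((LinearMap.range f).subtype.comp b.symm.toLinearMap).toAddMonoidHom,
    (b.toLinearMap.comp f.rangeRestrict).toAddMonoidHom, fun w => ?_, fun v => ?_⟩
  · change b (f.rangeRestrict (b.symm w : Fin d → ℤ)) = w
    rw [← b.eq_symm_apply]
    obtain ⟨v, hv⟩ := (b.symm w).2
    ext1
    change f (b.symm w : Fin d → ℤ) = _
    rw [← hv]
    exact he v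
  · change ((b.symm (b (f.rangeRestrict v)) : LinearMap.range f) : Fin d → ℤ) = e v
    rw [b.symm_apply_apply]
    rfl

theorem MixedLaurent.single_eq_mul_prod (R : Type*) [CommRing R] {d m : ℕ} (v : Fin d → ℤ)
    (n : Fin m → ℕ) :
    (AddMonoidAlgebra.single (v, n) 1 : MixedLaurent R d m) =
      AddMonoidAlgebra.single (v, 0) 1 *
        ∏ k, AddMonoidAlgebra.single (0, Pi.single k 1) 1 ^ n k := by
  have h : ∀ k, (AddMonoidAlgebra.single (0, Pi.single k 1) 1 ^ n k : MixedLaurent R d m) =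
      AddMonoidAlgebra.of R _ (Multiplicative.ofAdd (0, Pi.single k (n k))) := by
    intro k
    rw [AddMonoidAlgebra.single_pow, one_pow, AddMonoidAlgebra.of_apply]
    congr 1
    simp [← Pi.single_smul]
  simp_rw [h]
  rw [← map_prod, ← ofAdd_sum, AddMonoidAlgebra.of_apply, AddMonoidAlgebra.single_mul_single,
    one_mul]
  congr 1
  rw [toAdd_ofAdd]
  refine Prod.ext ?_ ?_
  · simp [Prod.fst_sum]
  · simp [Prod.snd_sum, Finset.univ_sum_single]

/-- The homomorphism from the mixed Laurent ring sending `x^v` to a unit multiple of the Laurent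
monomial of exponent `κ v` and the polynomial variables to themselves. -/
noncomputable def MixedLaurent.toMvPolynomial {R : Type*} [CommRing R] {d m r : ℕ}
    (κ : (Fin d → ℤ) →+ (Fin r → ℤ)) (c : Multiplicative (Fin d → ℤ) →* Rˣ) :
    MixedLaurent R d m →ₐ[R] MvPolynomial (Fin m) (AddMonoidAlgebra R (Fin r → ℤ)) :=
  AddMonoidAlgebra.lift R _ _
    { toFun := fun p => MvPolynomial.C (AddMonoidAlgebra.single (κ p.toAdd.1)
          (c (Multiplicative.ofAdd p.toAdd.1) : R)) * ∏ k, MvPolynomial.X k ^ p.toAdd.2 k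
      map_one' := by simp [← AddMonoidAlgebra.one_def]
      map_mul' := fun p q => by
        have h : (AddMonoidAlgebra.single (κ (p.toAdd.1 + q.toAdd.1))
            (c (Multiplicative.ofAdd (p.toAdd.1 + q.toAdd.1)) : R)) =
            AddMonoidAlgebra.single (κ p.toAdd.1) (c (Multiplicative.ofAdd p.toAdd.1) : R) *
            AddMonoidAlgebra.single (κ q.toAdd.1) (c (Multiplicative.ofAdd q.toAdd.1) : R) := by
          rw [AddMonoidAlgebra.single_mul_single, map_add, ofAdd_add, map_mul, Units.val_mul]
        simp only [toAdd_mul, Prod.fst_add, Prod.snd_add, Pi.add_apply, pow_add,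
          Finset.prod_mul_distrib, h, map_mul]
        ring }

theorem MixedLaurent.toMvPolynomial_single {R : Type*} [CommRing R] {d m r : ℕ}
    (κ : (Fin d → ℤ) →+ (Fin r → ℤ)) (c : Multiplicative (Fin d → ℤ) →* Rˣ)
    (v : Fin d → ℤ) (n : Fin m → ℕ) (a : R) :
    toMvPolynomial κ c (AddMonoidAlgebra.single (v, n) a) =
      a • (MvPolynomial.C (AddMonoidAlgebra.single (κ v) (c (Multiplicative.ofAdd v) : R)) *
        ∏ k, MvPolynomial.X k ^ n k) :=
  AddMonoidAlgebra.lift_single _ _ _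

theorem MixedLaurent.exists_equiv_of_idempotent (R : Type*) [CommRing R] [IsDomain R]
    [UniqueFactorizationMonoid R] {d m : ℕ} (hm : m ≤ 2)
    (φ : MixedLaurent R d m →ₐ[R] MixedLaurent R d m) (hφ : φ.comp φ = φ) :
    ∃ r s : ℕ, s ≤ 2 ∧ Nonempty (φ.range ≃ₐ[R] MixedLaurent R r s) := by
  have hφ' : ∀ x, φ (φ x) = φ x := fun x => DFunLike.congr_fun hφ x
  obtain ⟨e, c, hec⟩ := exists_map_single R φ
  have hidem : ∀ v, e (e v) = e v ∧ c (Multiplicative.ofAdd (e v)) = 1 := by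
    intro v
    have h1 := hφ' (AddMonoidAlgebra.single (v, 0) 1)
    have h2 : (AddMonoidAlgebra.single (e v, 0) (c (Multiplicative.ofAdd v) : R) :
        MixedLaurent R d m) =
        (c (Multiplicative.ofAdd v) : R) • AddMonoidAlgebra.single (e v, 0) 1 := by simp
    rw [hec, h2, map_smul, hec, ← h2, AddMonoidAlgebra.smul_single, smul_eq_mul] at h1
    rcases AddMonoidAlgebra.single_inj.1 h1 with ⟨h3, h4⟩ | ⟨-, h3⟩
    · exact ⟨congrArg Prod.fst h3, Units.ext (by simpa using h4)⟩
    · exact absurd h3 (Units.ne_zero _)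
  obtain ⟨r, ι, κ, hκι, hικ⟩ := e.exists_factor_of_idempotent fun v => (hidem v).1
  have heι : ∀ w, e (ι w) = ι w := fun w => by rw [← hικ, hκι]
  have hcι : ∀ w, c (Multiplicative.ofAdd (ι w)) = 1 := fun w => by
    rw [← heι, (hidem _).2]
  let S := AddMonoidAlgebra R (Fin r → ℤ)
  have : UniqueFactorizationMonoid S := AddMonoidAlgebra.uniqueFactorizationMonoid_pi_int R r
  let j : S →ₐ[R] φ.range := φ.rangeRestrict.comp
    (AddMonoidAlgebra.mapDomainAlgHom R R ((AddMonoidHom.inl _ _).comp ι))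
  have hj : ∀ w, (j (AddMonoidAlgebra.single w 1) : MixedLaurent R d m) =
      AddMonoidAlgebra.single (ι w, 0) 1 := fun w => by
    change φ (AddMonoidAlgebra.mapDomain _ (AddMonoidAlgebra.single w 1)) = _
    rw [AddMonoidAlgebra.mapDomain_single]
    exact (hec (ι w)).trans (by rw [heι, hcι, Units.val_one])
  let ψ : MixedLaurent R d m →ₐ[R] MvPolynomial (Fin m) S := toMvPolynomial κ c
  let : Algebra S φ.range := j.toRingHom.toAlgebra
  have halg : ∀ s : S, algebraMap S φ.range s = j s := fun s => rfl
  have : IsScalarTower R S φ.range := IsScalarTower.of_algebraMap_eq fun x => by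
    rw [halg, AlgHom.commutes]
  let π : MvPolynomial (Fin m) S →ₐ[S] φ.range := MvPolynomial.aeval fun k =>
    φ.rangeRestrict (AddMonoidAlgebra.single (0, Pi.single k 1) 1)
  have hψj : ∀ s : S, ψ (j s) = MvPolynomial.C s := by
    have : (ψ.comp φ.range.val).comp j =
        (Algebra.ofId S (MvPolynomial (Fin m) S)).restrictScalars R := by
      refine AddMonoidAlgebra.algHom_ext (fun w => ?_) (Subsingleton.elim _ _)
      change ψ (j (AddMonoidAlgebra.single w 1)) = MvPolynomial.C (AddMonoidAlgebra.single w 1)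
      rw [hj]
      refine (toMvPolynomial_single κ c (ι w) 0 1).trans ?_
      rw [hcι, hκι]
      simp
    exact fun s => DFunLike.congr_fun this s
  have hπψ : ∀ b, π (ψ b) = φ.rangeRestrict b := by
    have : (π.restrictScalars R).comp ψ = φ.rangeRestrict := by
      refine AddMonoidAlgebra.algHom_ext (fun p => ?_) (Subsingleton.elim _ _)
      obtain ⟨v, n⟩ := p
      change π (toMvPolynomial κ c (AddMonoidAlgebra.single (v, n) 1)) = _
      rw [toMvPolynomial_single, one_smul, map_mul, map_prod, single_eq_mul_prod, map_mul, map_prod,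
        ← MvPolynomial.algebraMap_eq, AlgHom.commutes, halg]
      congr 1
      · have h2 : (AddMonoidAlgebra.single (κ v) (c (Multiplicative.ofAdd v) : R) : S) =
            (c (Multiplicative.ofAdd v) : R) • AddMonoidAlgebra.single (κ v) 1 := by simp
        rw [h2, map_smul]
        ext1
        rw [Subalgebra.coe_smul, hj, hικ]
        refine Eq.trans ?_ (hec v).symm
        simp
      · refine Finset.prod_congr rfl fun k _ => ?_
        rw [map_pow, map_pow, MvPolynomial.aeval_X]
    exact fun b => DFunLike.congr_fun this b
  let i : φ.range →ₐ[S] MvPolynomial (Fin m) S :=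
    { (ψ.comp φ.range.val).toRingHom with
      commutes' := fun s => hψj s }
  have hπi : ∀ a, π (i a) = a := by
    rintro ⟨_, b, rfl⟩
    refine (hπψ _).trans (Subtype.ext ?_)
    exact hφ' b
  obtain ⟨s, hs, ⟨E⟩⟩ := MvPolynomial.nonempty_algEquiv_of_retract hm i π hπi
  exact ⟨r, s, hs, ⟨(E.restrictScalars R).trans (mvPolynomialEquiv R r s)⟩⟩

/-- Let `R` be a UFD, `1 ≤ d ≤ n = 3` (i.e. `d + m = 3`),
`B = R[x₁^{±1}, …, x_d^{±1}, x_{d+1}, …, x₃]`, `φ` an idempotent `R`-algebra endomorphism of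
`B`, `A = φ(B)` and `r = rank U_R(A)`.  Then
`A ≅ R^{[±r]} ⊗_R R^{[s]} = R[y₁^{±1}, …, y_r^{±1}, z₁, …, z_s]` for some `s ∈ {0, 1, 2}`. -/
theorem retract_classification_three_vars (R : Type*) [CommRing R] [IsDomain R]
    [UniqueFactorizationMonoid R] (d m : ℕ) (hd : 1 ≤ d) (hn : d + m = 3)
    (φ : MixedLaurent R d m →ₐ[R] MixedLaurent R d m) (hφ : φ.comp φ = φ)
    (r : ℕ) (hr : groupRank (URGroup R φ.range) = (r : Cardinal)) :
    ∃ s : ℕ, s ≤ 2 ∧ Nonempty (φ.range ≃ₐ[R] MixedLaurent R r s) := by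
  obtain ⟨r', s, hs, ⟨E⟩⟩ := MixedLaurent.exists_equiv_of_idempotent R (by omega) φ hφ
  have h := groupRank_URGroup_congr E
  rw [hr, MixedLaurent.groupRank_URGroup, Cardinal.lift_natCast, Cardinal.lift_natCast,
    Nat.cast_inj] at h
  subst h
  exact ⟨s, hs, ⟨E⟩⟩
end
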